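/- arXiv:math/0206124 — 7 statements merged into one kernel-verified Lean document; each statement's English description precedes it below -/
import Mathlib

section
/- Let 𝒜 be a weakly reflective subcategory of a category 𝒳 having equalizers and cokernel pairs. Then for every monomorphism m : M ⟶ X in 𝒳, the 𝒜-regular closure of m is computed by c_𝒜(m) ≅ eq(r_Y∘i, r_Y∘j), where (i, j : X ⟶ Y) is the cokernel pair of m and r_Y : Y ⟶ A is a weak 𝒜-reflection of Y; that is, eq(r_Y∘i, r_Y∘j) is an 𝒜-regular monomorphism lying above m which factors through every 𝒜-regular monomorphism lying above m. -/
open CategoryTheory Limits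

universe v u

namespace RegularClosure

variable {C : Type u} [Category.{v} C]

/-- `m` factors through `t`: `m ≤ t` in the preorder of (mono)morphisms into `X`. -/
def MonoLE {M T X : C} (m : M ⟶ X) (t : T ⟶ X) : Prop :=
  ∃ u : M ⟶ T, u ≫ t = m

/-- `f` is an `A`-regular monomorphism: an equalizer of a pair of morphisms with
common codomain in `A`. -/
def IsARegular (A : Set C) {M X : C} (f : M ⟶ X) : Prop :=
  ∃ (Z : C) (h k : X ⟶ Z) (w : f ≫ h = f ≫ k),
    Z ∈ A ∧ Nonempty (IsLimit (Fork.ofι f w))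

/-- `c` is the `A`-regular closure of `m`: the infimum, in the subobject preorder of `X`,
of all `A`-regular monomorphisms lying above `m`. -/
def IsRegClosure (A : Set C) {M X T : C} (m : M ⟶ X) (c : T ⟶ X) : Prop :=
  Mono c ∧
  (∀ {T' : C} (t : T' ⟶ X), Mono t → IsARegular A t → MonoLE m t → MonoLE c t) ∧
  (∀ {S : C} (s : S ⟶ X), Mono s →
    (∀ {T' : C} (t : T' ⟶ X), Mono t → IsARegular A t → MonoLE m t → MonoLE s t) →
    MonoLE s c)

/-- `A` and `B` induce the same regular closure operators (up to isomorphism). -/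
def SameRegClosure (A B : Set C) : Prop :=
  ∀ {M X T : C} (m : M ⟶ X), Mono m → ∀ c : T ⟶ X,
    IsRegClosure A m c ↔ IsRegClosure B m c

/-- `r : X ⟶ RX` is a weak `A`-reflection of `X`. -/
def IsWeakReflection (A : Set C) {X RX : C} (r : X ⟶ RX) : Prop :=
  RX ∈ A ∧ ∀ {B : C}, B ∈ A → ∀ f : X ⟶ B, ∃ g : RX ⟶ B, r ≫ g = f

/-- `A` is a weakly reflective subcategory. -/
def WeaklyReflective (A : Set C) : Prop :=
  ∀ X : C, ∃ (RX : C) (r : X ⟶ RX), IsWeakReflection A r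

/-- `A` is a weakly monoreflective subcategory. -/
def WeaklyMonoreflective (A : Set C) : Prop :=
  ∀ X : C, ∃ (RX : C) (r : X ⟶ RX), IsWeakReflection A r ∧ Mono r

/-- `r : X ⟶ RX` is an `A`-reflection of `X`. -/
def IsReflection (A : Set C) {X RX : C} (r : X ⟶ RX) : Prop :=
  RX ∈ A ∧ ∀ {B : C}, B ∈ A → ∀ f : X ⟶ B, ∃! g : RX ⟶ B, r ≫ g = f

/-- `A` is a reflective subcategory. -/
def ReflectiveSub (A : Set C) : Prop :=
  ∀ X : C, ∃ (RX : C) (r : X ⟶ RX), IsReflection A r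

/-- `A` is a monoreflective subcategory. -/
def Monoreflective (A : Set C) : Prop :=
  ∀ X : C, ∃ (RX : C) (r : X ⟶ RX), IsReflection A r ∧ Mono r

/-- `C` has cokernel pairs. -/
def HasCokernelPairs (C : Type u) [Category.{v} C] : Prop :=
  ∀ {M X : C} (m : M ⟶ X), HasPushout m m

/-- `f` is an epimorphism relative to the full subcategory with object class `B`. -/
def IsEpiIn (B : Set C) {X Y : C} (f : X ⟶ Y) : Prop :=
  ∀ {Z : C}, Z ∈ B → ∀ u v : Y ⟶ Z, f ≫ u = f ≫ v → u = v

/-- `f` is a monomorphism relative to the full subcategory with object class `A`. -/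
def IsMonoIn (A : Set C) {X Y : C} (f : X ⟶ Y) : Prop :=
  ∀ {Z : C}, Z ∈ A → ∀ u v : Z ⟶ X, u ≫ f = v ≫ f → u = v

/-- `S(A)`: the objects admitting a monomorphism into some `A`-object. -/
def SClos (A : Set C) : Set C := {X : C | ∃ A' ∈ A, ∃ m : X ⟶ A', Mono m}

/-- `m` is an extremal monomorphism. -/
def ExtremalMono {X Y : C} (m : X ⟶ Y) : Prop :=
  Mono m ∧ ∀ {Z : C} (e : X ⟶ Z) (g : Z ⟶ Y), Epi e → e ≫ g = m → IsIso e

/-- `f` is an extremal epimorphism. -/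
def ExtremalEpi {X Y : C} (f : X ⟶ Y) : Prop :=
  Epi f ∧ ∀ {Z : C} (g : X ⟶ Z) (m : Z ⟶ Y), Mono m → g ≫ m = f → IsIso m

/-- `A` is an epireflective subcategory of the full subcategory on `B`. -/
def EpireflectiveIn (A B : Set C) : Prop :=
  A ⊆ B ∧ ∀ X ∈ B, ∃ (RX : C) (r : X ⟶ RX), RX ∈ A ∧ IsEpiIn B r ∧
    ∀ {Z : C}, Z ∈ A → ∀ f : X ⟶ Z, ∃! g : RX ⟶ Z, r ≫ g = f

/-- `B` is an intermediate subcategory of the pair `(A, C)`: `C`-epireflective in `C`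
and containing `A` as a `B`-epireflective subcategory (so that the reflector onto `A`
factors as a composite of the two epireflectors). -/
def Intermediate (A B : Set C) : Prop :=
  EpireflectiveIn B Set.univ ∧ EpireflectiveIn A B

/-- The full subcategory on `A` is cowellpowered: every `A`-object admits, up to
equivalence, only a set of epimorphisms (relative to `A`) with that object as domain. -/
def CowellpoweredSub (A : Set C) : Prop :=
  ∀ X : C, X ∈ A → ∃ (ι : Type v) (Q : ι → C) (q : ∀ i, X ⟶ Q i),
    (∀ i, Q i ∈ A ∧ IsEpiIn A (q i)) ∧
    ∀ {Y : C} (f : X ⟶ Y), Y ∈ A → IsEpiIn A f → ∃ (i : ι) (e : Q i ≅ Y), q i ≫ e.hom = f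

/-- `C` is wellpowered: every object has, up to equivalence, only a set of subobjects. -/
def WellpoweredCat (C : Type u) [Category.{v} C] : Prop :=
  ∀ X : C, ∃ (ι : Type v) (S : ι → C) (s : ∀ i, S i ⟶ X),
    (∀ i, Mono (s i)) ∧
    ∀ {Y : C} (f : Y ⟶ X), Mono f → ∃ (i : ι) (e : S i ≅ Y), e.hom ≫ f = s i

/-- `C` has intersections of (set-indexed) families of subobjects. -/
def HasIntersections (C : Type u) [Category.{v} C] : Prop :=
  ∀ {X : C} (ι : Type v) (D : ι → C) (f : ∀ i, D i ⟶ X), (∀ i, Mono (f i)) →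
    ∃ (P : C) (p : P ⟶ X), Mono p ∧ (∀ i, MonoLE p (f i)) ∧
      ∀ {S : C} (s : S ⟶ X), Mono s → (∀ i, MonoLE s (f i)) → MonoLE s p

/-- Every morphism of `C` factors as an epimorphism followed by a monomorphism. -/
def EpiMonoFact (C : Type u) [Category.{v} C] : Prop :=
  ∀ {X Y : C} (f : X ⟶ Y), ∃ (Z : C) (e : X ⟶ Z) (m : Z ⟶ Y), Epi e ∧ Mono m ∧ e ≫ m = f

/-- Every morphism of `C` factors as a strong epimorphism followed by a monomorphism. -/
def StrongEpiMonoFact (C : Type u) [Category.{v} C] : Prop :=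
  ∀ {X Y : C} (f : X ⟶ Y), ∃ (Z : C) (e : X ⟶ Z) (m : Z ⟶ Y), StrongEpi e ∧ Mono m ∧ e ≫ m = f

/-- For each `X ∈ B` and every `U`, any canonical morphism
`α : r(U ⨯ X) ⟶ r U ⨯ r X` (i.e. one whose composites with the product projections are the
reflected projections) is a monomorphism in `A`; here `R`, `η` are the reflection data of `A`. -/
def AlphaMonoHyp [HasBinaryProducts C] (A : Set C) (R : C → C) (η : ∀ X : C, X ⟶ R X)
    (B : Set C) : Prop :=
  ∀ (U X : C), X ∈ B → ∀ α : R (U ⨯ X) ⟶ R U ⨯ R X,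
    η (U ⨯ X) ≫ α ≫ prod.fst = prod.fst ≫ η U →
    η (U ⨯ X) ≫ α ≫ prod.snd = prod.snd ≫ η X →
    IsMonoIn A α

/-- `f` is `A`-cancellable. -/
def Cancellable (A : Set C) {X Y : C} (f : X ⟶ Y) : Prop :=
  ∀ {Z : C}, Z ∈ A → ∀ h k : Y ⟶ Z, f ≫ h = f ≫ k → h = k

/-- `f` is an `A`-epimorphism (defined by the same cancellation condition). -/
def AEpimorphism (A : Set C) {X Y : C} (f : X ⟶ Y) : Prop :=
  ∀ {Z : C}, Z ∈ A → ∀ h k : Y ⟶ Z, f ≫ h = f ≫ k → h = k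

/-- The Pumplün–Röhrl closure `E(A)`: the objects that are Hausdorff with respect to the
class of `A`-cancellable morphisms. -/
def EClos (A : Set C) : Set C :=
  {X : C | ∀ {P Q : C} (p : P ⟶ Q), Cancellable A p → Cancellable ({X} : Set C) p}

/-- The Hoffmann closure `D(A)`: the objects that are Hausdorff with respect to the
class of `A`-epimorphisms. -/
def DClos (A : Set C) : Set C :=
  {X : C | ∀ {P Q : C} (p : P ⟶ Q), AEpimorphism A p → AEpimorphism ({X} : Set C) p}

/-- Condition (*) for the `A`-reflection data `(R, η)`. -/
def StarCondition (A : Set C) (R : C → C) (η : ∀ X : C, X ⟶ R X) : Prop :=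
  ∀ X : C, X ∉ A → ∃ (Z : C) (f g : Z ⟶ X),
    f ≠ g ∧ f ≫ η X = g ≫ η X ∧
    ∃ gbar : X ⟶ Z, g ≫ gbar = f ≫ gbar ∧ g ≫ gbar ≫ g = g

/-- If `A` is weakly reflective in a category with equalizers and cokernel
pairs, then for every monomorphism `m : M ⟶ X` with cokernel pair `(i, j : X ⟶ Y)` and weak
`A`-reflection `r : Y ⟶ RY`, the equalizer of `i ≫ r` and `j ≫ r` is an `A`-regular
monomorphism lying above `m` which factors through every `A`-regular monomorphism lying
above `m` (i.e. it is the `A`-regular closure of `m`). -/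
theorem statement0 [HasEqualizers C]
    (hcp : HasCokernelPairs C)
    (A : Set C) (hA : WeaklyReflective A)
    {M X : C} (m : M ⟶ X) (hm : Mono m)
    (Y : C) (i j : X ⟶ Y) (w : m ≫ i = m ≫ j)
    (hco : Nonempty (IsColimit (PushoutCocone.mk i j w)))
    (RY : C) (r : Y ⟶ RY) (hr : IsWeakReflection A r) :
    IsARegular A (equalizer.ι (i ≫ r) (j ≫ r)) ∧
    MonoLE m (equalizer.ι (i ≫ r) (j ≫ r)) ∧
    ∀ {T : C} (t : T ⟶ X), Mono t → IsARegular A t → MonoLE m t →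
      MonoLE (equalizer.ι (i ≫ r) (j ≫ r)) t := by
  refine ⟨⟨RY, i ≫ r, j ≫ r, equalizer.condition _ _, hr.1, ⟨equalizerIsEqualizer _ _⟩⟩,
    ⟨equalizer.lift m (by rw [← Category.assoc, w, Category.assoc]), equalizer.lift_ι _ _⟩, ?_⟩
  rintro T t - ⟨Z, h, k, wt, hZ, ⟨ht⟩⟩ ⟨u, rfl⟩
  obtain ⟨hco⟩ := hco
  obtain ⟨d, hdi, hdj⟩ := PushoutCocone.IsColimit.desc' hco h k (by simp [wt])
  obtain ⟨g, rfl⟩ := hr.2 hZ d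
  change i ≫ r ≫ g = h at hdi
  change j ≫ r ≫ g = k at hdj
  obtain ⟨l, hl⟩ := Fork.IsLimit.lift' ht (equalizer.ι (i ≫ r) (j ≫ r)) (by
    rw [← hdi, ← hdj]
    simpa using congrArg (· ≫ g) (equalizer.condition (i ≫ r) (j ≫ r)))
  exact ⟨l, hl⟩

end RegularClosure
end

section
/- Let 𝒜 be a weakly monoreflective subcategory of a category 𝒳 having equalizers and cokernel pairs. Then for every monomorphism m : M ⟶ X one has c_𝒜(m) ≅ eq(r_Y∘i, r_Y∘j) ≅ c(m), where (i, j : X ⟶ Y) is the cokernel pair of m, r_Y is the weak 𝒜-reflection of Y, and c(m) denotes the intersection of all regular monomorphisms of 𝒳 lying above m (the regular closure induced by 𝒳 itself). In particular, the smallest 𝒜-regular monomorphism above m coincides with the smallest regular monomorphism of 𝒳 above m. -/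
open CategoryTheory Limits

universe v u

namespace RegularClosure

variable {C : Type u} [Category.{v} C]

/-- The equalizer of the cokernel pair of `m`, followed by a monomorphism into an object of `A`,
is the smallest `A`-regular monomorphism above `m`. -/
theorem isRegClosure_equalizer_cokernelPair [HasEqualizers C] (A : Set C)
    {M X Y R : C} {m : M ⟶ X} {i j : X ⟶ Y} {w : m ≫ i = m ≫ j}
    (hco : IsColimit (PushoutCocone.mk i j w)) (r : Y ⟶ R) (hR : R ∈ A) [Mono r] :
    IsRegClosure A m (equalizer.ι (i ≫ r) (j ≫ r)) := by
  refine ⟨inferInstance, ?_, ?_⟩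
  · rintro T t - ⟨Z, h, k, ht, -, ⟨hl⟩⟩ ⟨u, hu⟩
    have hm : m ≫ h = m ≫ k := by simp only [← hu, Category.assoc, ht]
    obtain ⟨d, hi, hj⟩ : ∃ d : Y ⟶ Z, i ≫ d = h ∧ j ≫ d = k :=
      ⟨hco.desc (PushoutCocone.mk h k hm), hco.fac _ .left, hco.fac _ .right⟩
    have he : equalizer.ι (i ≫ r) (j ≫ r) ≫ i = equalizer.ι (i ≫ r) (j ≫ r) ≫ j := by
      rw [← cancel_mono r, Category.assoc, Category.assoc, equalizer.condition]
    have hhk : equalizer.ι (i ≫ r) (j ≫ r) ≫ h = equalizer.ι (i ≫ r) (j ≫ r) ≫ k := by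
      rw [← hi, ← hj, reassoc_of% he]
    obtain ⟨l, hl⟩ := Fork.IsLimit.lift' hl _ hhk
    exact ⟨l, hl⟩
  · intro S s _ hs
    exact hs _ inferInstance
      ⟨R, i ≫ r, j ≫ r, equalizer.condition _ _, hR, ⟨equalizerIsEqualizer _ _⟩⟩
      ⟨equalizer.lift m (by rw [reassoc_of% w]), equalizer.lift_ι _ _⟩

/-- If `A` is weakly monoreflective in a category with equalizers and
cokernel pairs, then for every monomorphism `m : M ⟶ X` with cokernel pair
`(i, j : X ⟶ Y)` and weak `A`-reflection `r : Y ⟶ RY` (a monomorphism), the equalizer of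
`i ≫ r` and `j ≫ r` is simultaneously the `A`-regular closure `c_A(m)` of `m` and the
regular closure `c(m)` of `m` induced by the whole category. -/
theorem statement2 [HasEqualizers C]
    (hcp : HasCokernelPairs C)
    (A : Set C) (hA : WeaklyMonoreflective A)
    {M X : C} (m : M ⟶ X) (hm : Mono m)
    (Y : C) (i j : X ⟶ Y) (w : m ≫ i = m ≫ j)
    (hco : Nonempty (IsColimit (PushoutCocone.mk i j w)))
    (RY : C) (r : Y ⟶ RY) (hr : IsWeakReflection A r) (hrm : Mono r) :
    IsRegClosure A m (equalizer.ι (i ≫ r) (j ≫ r)) ∧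
    IsRegClosure (Set.univ : Set C) m (equalizer.ι (i ≫ r) (j ≫ r)) := by
  obtain ⟨hco⟩ := hco
  exact ⟨isRegClosure_equalizer_cokernelPair A hco r hr.1,
    isRegClosure_equalizer_cokernelPair Set.univ hco r (Set.mem_univ _)⟩

end RegularClosure
end

section
/- Let 𝒳 be a cowellpowered category with products, equalizers and cokernel pairs in which every morphism factors as an epimorphism followed by a monomorphism. Let 𝒜 be a reflective subcategory of 𝒳 and let ℬ be the full subcategory of 𝒳 whose objects are the 𝒳-subobjects of 𝒜-objects. Then 𝒜 and ℬ induce the same regular closure operators: c_𝒜(m) ≅ c_ℬ(m) for every monomorphism m. -/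
open CategoryTheory Limits

universe v u

namespace RegularClosure

variable {C : Type u} [Category.{v} C]

/-- Regular monomorphisms induced by `A` and by the class `SClos A` of its subobjects agree:
composing a parallel pair with a monomorphism does not change its equalizer. -/
theorem isARegular_sClos_iff (A : Set C) {M X : C} (f : M ⟶ X) :
    IsARegular (SClos A) f ↔ IsARegular A f := by
  constructor
  · rintro ⟨Z, h, k, w, ⟨A', hA', n, hn⟩, ⟨hl⟩⟩
    exact ⟨A', h ≫ n, k ≫ n, by rw [reassoc_of% w], hA', ⟨isEqualizerCompMono hl n⟩⟩
  · rintro ⟨Z, h, k, w, hZ, hl⟩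
    exact ⟨Z, h, k, w, ⟨Z, hZ, 𝟙 Z, inferInstance⟩, hl⟩

/-- Let `C` be a cowellpowered category with products, equalizers and
cokernel pairs in which every morphism factors as an epimorphism followed by a
monomorphism. Let `A` be a reflective subcategory and let `B` be the full subcategory
whose objects are the `C`-subobjects of `A`-objects (i.e. `S(A)`). Then `A` and `B`
induce the same regular closure operators. -/
theorem statement6 [HasEqualizers C] [HasProducts.{v} C]
    (hcp : HasCokernelPairs C)
    (hcow : CowellpoweredSub (Set.univ : Set C))
    (hfact : EpiMonoFact C)
    (A : Set C) (hA : ReflectiveSub A)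
    (B : Set C) (hB : B = SClos A) :
    SameRegClosure A B := by
  subst hB
  intro M X T m _ c
  simp only [IsRegClosure, isARegular_sClos_iff]

end RegularClosure
end

section
/- Let ℬ be a reflective subcategory of 𝒳 (𝒳 having finite products, equalizers and cokernel pairs), and let 𝒜 be an extremally epireflective subcategory of 𝒳 satisfying condition (*). If 𝒜 and ℬ induce the same regular closure operators, then ℬ ⊆ 𝒜. -/
open CategoryTheory Limits

universe v u

namespace RegularClosure

variable {C : Type u} [Category.{v} C]

/-- An `A`-regular monomorphism is its own `A`-regular closure. -/
theorem IsARegular.isRegClosure_self {A : Set C} {M X : C} {m : M ⟶ X} [Mono m]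
    (hm : IsARegular A m) : IsRegClosure A m m :=
  ⟨inferInstance, fun _ _ _ hle => hle,
    fun _ _ hs => hs m inferInstance hm ⟨𝟙 _, Category.id_comp m⟩⟩

/-- The diagonal of an object of `B` is `B`-regular: it is the equalizer of the projections. -/
theorem isARegular_diag [HasBinaryProducts C] {B : Set C} {X : C} (hX : X ∈ B) :
    IsARegular B (diag X) := by
  refine ⟨X, prod.fst, prod.snd, by rw [prod.lift_fst, prod.lift_snd], hX, ⟨Fork.IsLimit.mk' _ fun s => ?_⟩⟩
  have hs : s.ι ≫ prod.fst = s.ι ≫ prod.snd := s.condition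
  refine ⟨s.ι ≫ prod.fst, ?_, fun {l} hl => ?_⟩
  · change (s.ι ≫ prod.fst) ≫ diag X = s.ι
    apply Limits.prod.hom_ext
    · rw [Category.assoc, prod.lift_fst, Category.comp_id]
    · rw [Category.assoc, prod.lift_snd, Category.comp_id, hs]
  · change l ≫ diag X = s.ι at hl
    calc l = l ≫ diag X ≫ prod.fst := ((congrArg (l ≫ ·) (prod.lift_fst (𝟙 X) (𝟙 X))).trans
          (Category.comp_id l)).symm
      _ = s.ι ≫ prod.fst := by rw [← Category.assoc, hl]

/-- If `m` is its own `A`-regular closure, with `A` reflective, then every morphism which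
equalizes all pairs into `A`-objects agreeing on `m` factors through `m`. -/
theorem monoLE_of_isRegClosure_self [HasEqualizers C] (hcp : HasCokernelPairs C)
    {A : Set C} {R : C → C} {η : ∀ X : C, X ⟶ R X} (hA : ∀ X : C, IsReflection A (η X))
    {M X W : C} {m : M ⟶ X} (hm : IsRegClosure A m m) (w : W ⟶ X)
    (hw : ∀ {Y : C}, Y ∈ A → ∀ h k : X ⟶ Y, m ≫ h = m ≫ k → w ≫ h = w ≫ k) :
    MonoLE w m := by
  have := hcp m
  let p := pushout.inl m m ≫ η (pushout m m)
  let q := pushout.inr m m ≫ η (pushout m m)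
  have hpq : m ≫ p = m ≫ q := pushout.condition_assoc _
  obtain ⟨u, hu⟩ : MonoLE (equalizer.ι p q) m := by
    refine hm.2.2 _ inferInstance fun t _ ⟨Y, h, k, e, hY, ⟨hl⟩⟩ ⟨v, hv⟩ => ?_
    have hmhk : m ≫ h = m ≫ k := by rw [← hv, Category.assoc, Category.assoc, e]
    obtain ⟨d, hd, -⟩ := (hA (pushout m m)).2 hY (pushout.desc h k hmhk)
    have hp : p ≫ d = h := by rw [Category.assoc, hd, pushout.inl_desc]
    have hq : q ≫ d = k := by rw [Category.assoc, hd, pushout.inr_desc]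
    obtain ⟨l, hl'⟩ := Fork.IsLimit.lift' hl (equalizer.ι p q) (by
      rw [← hp, ← hq, equalizer.condition_assoc])
    exact ⟨l, hl'⟩
  exact ⟨equalizer.lift w (hw (hA _).1 p q hpq) ≫ u, by simp [hu]⟩

/-- Let `B` be a reflective subcategory of `C` (which has finite
products, equalizers and cokernel pairs), and let `A` be an extremally epireflective
subcategory (reflection data `(RA, η)`, all reflection morphisms extremal epimorphisms)
satisfying condition (*). If `A` and `B` induce the same regular closure operators, then
`B ⊆ A`. -/
theorem statement13 [HasEqualizers C] [HasFiniteProducts C]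
    (hcp : HasCokernelPairs C)
    (A : Set C) (RA : C → C) (η : ∀ X : C, X ⟶ RA X)
    (hA : ∀ X : C, IsReflection A (η X))
    (hAext : ∀ X : C, ExtremalEpi (η X))
    (hstar : StarCondition A RA η)
    (B : Set C) (hB : ReflectiveSub B)
    (hsame : SameRegClosure A B) :
    B ⊆ A := by
  intro X hX
  by_contra hXA
  obtain ⟨Z, f, g, hne, hη, gbar, hgf, hg⟩ := hstar X hXA
  have hclosed : IsRegClosure A (diag X) (diag X) :=
    (hsame (diag X) inferInstance _).2 (isARegular_diag hX).isRegClosure_self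
  have hf : f ≫ gbar ≫ g = g := by rw [← Category.assoc, ← hgf, Category.assoc, hg]
  have hfactor : ∀ {Y : C}, Y ∈ A → ∀ h : X ⨯ X ⟶ Y,
      prod.lift f g ≫ h = g ≫ diag X ≫ h := by
    intro Y hY h
    obtain ⟨d, hd, -⟩ := (hA X).2 hY (prod.lift (𝟙 X) (gbar ≫ g) ≫ h)
    calc
      prod.lift f g ≫ h = f ≫ prod.lift (𝟙 X) (gbar ≫ g) ≫ h := by
        rw [← Category.assoc, prod.comp_lift, Category.comp_id, hf]
      _ = g ≫ prod.lift (𝟙 X) (gbar ≫ g) ≫ h := by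
        rw [← hd, ← Category.assoc, hη, Category.assoc]
      _ = g ≫ diag X ≫ h := by
        rw [← Category.assoc, ← Category.assoc, prod.comp_lift, prod.comp_lift,
          Category.comp_id, hg]
  obtain ⟨u, hu⟩ := monoLE_of_isRegClosure_self hcp hA hclosed (prod.lift f g)
    fun hY h k hhk => by rw [hfactor hY, hfactor hY, hhk]
  have hf' : f = u := by
    rw [← prod.lift_fst f g, ← hu, Category.assoc, prod.lift_fst, Category.comp_id]
  have hg' : g = u := by
    rw [← prod.lift_snd f g, ← hu, Category.assoc, prod.lift_snd, Category.comp_id]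
  exact hne (hf'.trans hg'.symm)

end RegularClosure
end

section
/- Let 𝒳 be a complete, wellpowered and cowellpowered category (with equalizers and cokernel pairs), let 𝒜 be a reflective and cowellpowered subcategory of 𝒳, and let ℬ be a reflective subcategory of 𝒳 such that 𝒜 and ℬ induce the same regular closure operators. If either (i) for each object X in ℬ the canonical morphism α_{U,X} (with respect to the reflector of 𝒜) is a monomorphism in 𝒜 for all objects U of 𝒳, or (ii) the terminal object of 𝒳 is a generator of 𝒳, then ℬ is cowellpowered. -/
open CategoryTheory Limits

universe v u

namespace RegularClosure

variable {C : Type u} [Category.{v} C]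

/-- In a wellpowered category with limits, every morphism has a smallest subobject of its codomain
through which it factors. -/
theorem exists_least_mono_factor [HasLimits C] (hwp : WellpoweredCat C) {X Y : C} (f : X ⟶ Y) :
    ∃ (M : C) (m : M ⟶ Y), Mono m ∧ MonoLE f m ∧
      ∀ {T : C} (t : T ⟶ Y), Mono t → MonoLE f t → MonoLE m t := by
  obtain ⟨ι, S, s, hs, hall⟩ := hwp Y
  let J := {j : ι // MonoLE f (s j)}
  let arrows : ∀ j : J, S j.1 ⟶ Y := fun j => s j.1
  refine ⟨widePullback Y (fun j : J => S j.1) arrows, WidePullback.base arrows, ⟨?_⟩, ?_, ?_⟩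
  · intro Z a b hab
    apply WidePullback.hom_ext
    · intro j
      have := hs j.1
      rw [← cancel_mono (s j.1)]
      simpa [arrows] using hab
    · exact hab
  · choose l hl using fun j : J => j.2
    exact ⟨WidePullback.lift f l hl, WidePullback.lift_base ..⟩
  · intro T t ht ⟨g, hg⟩
    obtain ⟨i, e, he⟩ := hall t ht
    let j : J := ⟨i, g ≫ e.inv, by simp [← he, hg]⟩
    exact ⟨WidePullback.π arrows j ≫ e.hom, by
      rw [Category.assoc, he]; exact WidePullback.π_arrow arrows j⟩

theorem isARegular_equalizer_ι [HasEqualizers C] {A : Set C} {X Z : C} (hZ : Z ∈ A)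
    (h k : X ⟶ Z) : IsARegular A (equalizer.ι h k) :=
  ⟨Z, h, k, equalizer.condition h k, hZ, ⟨equalizerIsEqualizer h k⟩⟩

theorem Cancellable.of_sameRegClosure [HasLimits C] (hwp : WellpoweredCat C) {A B : Set C}
    (hsame : SameRegClosure A B) {X Y : C} {f : X ⟶ Y} (hf : Cancellable B f) :
    Cancellable A f := by
  intro Z hZ h k hhk
  obtain ⟨M, m, hm, ⟨e, rfl⟩, hmin⟩ := exists_least_mono_factor hwp f
  have hB : IsRegClosure B m (𝟙 Y) := by
    refine ⟨inferInstance, ?_, fun s _ _ => ⟨s, Category.comp_id s⟩⟩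
    rintro T t - ⟨W, p, q, w, hW, ⟨hl⟩⟩ ⟨u, hu⟩
    have hpq : p = q := hf hW p q (by simp [← hu, w])
    obtain ⟨l, hl'⟩ := Fork.IsLimit.lift' hl (𝟙 Y) (by rw [hpq])
    exact ⟨l, hl'⟩
  obtain ⟨l, hl⟩ := ((hsame m hm _).2 hB).2.1 (equalizer.ι h k) inferInstance
    (isARegular_equalizer_ι hZ h k)
    (hmin _ inferInstance ⟨equalizer.lift _ hhk, equalizer.lift_ι _ _⟩)
  rw [← Category.id_comp h, ← Category.id_comp k, ← hl, Category.assoc, Category.assoc,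
    equalizer.condition]

/-- If `Y ∈ B`, the diagonal of `Y` is closed for the common regular closure operator, so morphisms
into `Y` are separated by the morphisms from `Y ⨯ Y` to objects of `A`. -/
theorem eq_of_lift_comp_eq [HasLimits C] (hwp : WellpoweredCat C) {A B : Set C}
    (hsame : SameRegClosure A B) {T Y : C} (hY : Y ∈ B) {a b : T ⟶ Y}
    (hab : ∀ {Z : C}, Z ∈ A → ∀ h : Y ⨯ Y ⟶ Z, prod.lift a b ≫ h = prod.lift a a ≫ h) :
    a = b := by
  have hreg : IsARegular B (diag Y) := by
    refine ⟨Y, prod.fst, prod.snd, by rw [prod.lift_fst, prod.lift_snd], hY, ⟨Fork.IsLimit.mk' _ fun s => ?_⟩⟩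
    refine ⟨s.ι ≫ prod.fst, ?_, fun {m} hm => ?_⟩
    · apply Limits.prod.hom_ext
      · simp [prod.lift_fst]
      · simpa [prod.lift_snd] using s.condition
    · simp [← hm, prod.lift_fst]
  have hB : IsRegClosure B (diag Y) (diag Y) :=
    ⟨inferInstance, fun t _ _ h => h,
      fun s _ hs => hs (diag Y) inferInstance hreg ⟨𝟙 Y, Category.id_comp _⟩⟩
  obtain ⟨M, m, hm, ⟨e, he⟩, hmin⟩ := exists_least_mono_factor hwp (prod.lift a b)
  obtain ⟨l, hl⟩ := ((hsame (diag Y) inferInstance _).2 hB).2.2 m hm (by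
    rintro T' t ht ⟨Z, h, k, w, hZ, ⟨hlim⟩⟩ ⟨u, hu⟩
    refine hmin t ht ?_
    have hd : diag Y ≫ h = diag Y ≫ k := by
      rw [← hu, Category.assoc, Category.assoc, w]
    have haa : prod.lift a a = a ≫ diag Y := by simp
    obtain ⟨l, hl⟩ := Fork.IsLimit.lift' hlim (prod.lift a b) (by
      rw [hab hZ h, hab hZ k, haa, Category.assoc, Category.assoc, hd])
    exact ⟨l, hl⟩)
  have hfac : prod.lift a b = (e ≫ l) ≫ diag Y := by rw [Category.assoc, hl, he]
  have h₁ := congrArg (· ≫ prod.fst) hfac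
  have h₂ := congrArg (· ≫ prod.snd) hfac
  simp only [prod.lift_fst, prod.lift_snd, Category.assoc, diag, Category.comp_id] at h₁ h₂
  rw [h₁, h₂]

theorem IsReflection.hom_ext {A : Set C} {X RX Z : C} {r : X ⟶ RX} (hr : IsReflection A r)
    (hZ : Z ∈ A) {g h : RX ⟶ Z} (w : r ≫ g = r ≫ h) : g = h :=
  (hr.2 hZ (r ≫ h)).unique w rfl

theorem mono_reflection_of_alphaMonoHyp [HasLimits C] (hwp : WellpoweredCat C) {A B : Set C}
    {RA : C → C} {η : ∀ X : C, X ⟶ RA X} (hA : ∀ X : C, IsReflection A (η X))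
    (hsame : SameRegClosure A B) (hα : AlphaMonoHyp A RA η B) {Y : C} (hY : Y ∈ B) :
    Mono (η Y) := by
  refine ⟨fun {T} a b hab => eq_of_lift_comp_eq hwp hsame hY fun {Z} hZ h => ?_⟩
  obtain ⟨p, hp, -⟩ := (hA (Y ⨯ Y)).2 (hA Y).1 (prod.fst ≫ η Y)
  obtain ⟨q, hq, -⟩ := (hA (Y ⨯ Y)).2 (hA Y).1 (prod.snd ≫ η Y)
  have hmono : IsMonoIn A (prod.lift p q) := hα Y Y hY (prod.lift p q) (by rwa [prod.lift_fst]) (by rwa [prod.lift_snd])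
  obtain ⟨x, hx, -⟩ := (hA T).2 (hA (Y ⨯ Y)).1 (prod.lift a b ≫ η (Y ⨯ Y))
  obtain ⟨y, hy, -⟩ := (hA T).2 (hA (Y ⨯ Y)).1 (prod.lift a a ≫ η (Y ⨯ Y))
  have hxy : x = y := by
    refine hmono (hA T).1 x y (Limits.prod.hom_ext ?_ ?_)
    · simp only [Category.assoc, prod.lift_fst]
      exact (hA T).hom_ext (hA Y).1 (by
        rw [reassoc_of% hx, reassoc_of% hy, hp, prod.lift_fst_assoc, prod.lift_fst_assoc])
    · simp only [Category.assoc, prod.lift_snd]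
      exact (hA T).hom_ext (hA Y).1 (by
        rw [reassoc_of% hx, reassoc_of% hy, hq, prod.lift_snd_assoc, prod.lift_snd_assoc, hab])
  obtain ⟨h', rfl, -⟩ := (hA (Y ⨯ Y)).2 hZ h
  rw [← reassoc_of% hx, ← reassoc_of% hy, hxy]

theorem mono_reflection_of_isSeparator_terminal [HasLimits C] (hwp : WellpoweredCat C)
    {A B : Set C} {RA : C → C} {η : ∀ X : C, X ⟶ RA X} (hA : ∀ X : C, IsReflection A (η X))
    (hsame : SameRegClosure A B) (hsep : IsSeparator (⊤_ C)) {Y : C} (hY : Y ∈ B) :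
    Mono (η Y) := by
  refine ⟨fun {T} a b hab => hsep.def _ _ fun t =>
    eq_of_lift_comp_eq hwp hsame hY fun {Z} hZ h => ?_⟩
  let i : Y ⟶ Y ⨯ Y := prod.lift (terminal.from Y ≫ t ≫ a) (𝟙 Y)
  have hi (c : ⊤_ C ⟶ Y) : prod.lift (t ≫ a) c = c ≫ i := by
    have hc : c ≫ terminal.from Y = 𝟙 _ := Subsingleton.elim _ _
    simp [i, prod.comp_lift, reassoc_of% hc]
  obtain ⟨g, hg, -⟩ := (hA Y).2 hZ (i ≫ h)
  simp only [hi, Category.assoc, ← hg, reassoc_of% hab]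

/-- A subcategory is cowellpowered as soon as the codomains of the relative epimorphisms with a
given domain form, up to isomorphism, a set. -/
theorem CowellpoweredSub.of_codomains {B : Set C}
    (h : ∀ X ∈ B, ∃ (ι : Type v) (D : ι → C), ∀ (Y : C) (f : X ⟶ Y), Y ∈ B → IsEpiIn B f →
      ∃ i, Nonempty (Y ≅ D i)) : CowellpoweredSub B := by
  intro X hX
  obtain ⟨ι, D, hD⟩ := h X hX
  let K := {p : Σ i, X ⟶ D i //
    ∃ (Y : C) (e : D p.1 ≅ Y), Y ∈ B ∧ IsEpiIn B (p.2 ≫ e.hom)}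
  choose Q e hQ using fun k : K => k.2
  refine ⟨K, Q, fun k => k.1.2 ≫ (e k).hom, hQ, fun {Y} f hY hf => ?_⟩
  obtain ⟨i, ⟨d⟩⟩ := hD Y f hY hf
  let k : K := ⟨⟨i, f ≫ d.hom⟩, Y, d.symm, hY, fun {Z} hZ u w huw => hf hZ u w (by simpa using huw)⟩
  exact ⟨k, (e k).symm ≪≫ d.symm, by simp [k]⟩

theorem CowellpoweredSub.of_mono_reflection (hwp : WellpoweredCat C) {A B : Set C}
    {RA : C → C} {η : ∀ X : C, X ⟶ RA X} (hA : ∀ X : C, IsReflection A (η X))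
    (hAcow : CowellpoweredSub A)
    (hcanc : ∀ {X Y : C} (f : X ⟶ Y), Cancellable B f → Cancellable A f)
    (hmono : ∀ Y ∈ B, Mono (η Y)) : CowellpoweredSub B := by
  refine .of_codomains fun X _ => ?_
  obtain ⟨ι, Q, q, -, hall⟩ := hAcow (RA X) (hA X).1
  choose κ S s hs hS using fun i => hwp (Q i)
  refine ⟨Σ i, κ i, fun p => S p.1 p.2, fun Y f hY hf => ?_⟩
  obtain ⟨g, hg, -⟩ := (hA X).2 (hA Y).1 (f ≫ η Y)
  have hgepi : IsEpiIn A g := fun {Z} hZ u w huw =>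
    (hA Y).hom_ext hZ (hcanc f (fun hW => hf hW) hZ _ _ (by
      rw [← Category.assoc, ← Category.assoc, ← hg, Category.assoc, Category.assoc, huw]))
  obtain ⟨i, e, -⟩ := hall g (hA Y).1 hgepi
  have := hmono Y hY
  obtain ⟨j, d, -⟩ := hS i (η Y ≫ e.inv) inferInstance
  exact ⟨⟨i, j⟩, ⟨d.symm⟩⟩

/-- Let `C` be a complete, wellpowered and cowellpowered category (with
equalizers and cokernel pairs), `A` a reflective and cowellpowered subcategory with
reflection data `(RA, η)`, and `B` a reflective subcategory inducing the same regular
closure operators as `A`. If either (i) the canonical morphisms `α_{U,X}` (for `X ∈ B`)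
are monomorphisms in `A`, or (ii) the terminal object of `C` is a generator, then `B` is
cowellpowered. -/
theorem statement14 [HasLimits C] [HasEqualizers C]
    (hcp : HasCokernelPairs C)
    (hwp : WellpoweredCat C) (hcow : CowellpoweredSub (Set.univ : Set C))
    (A : Set C) (RA : C → C) (η : ∀ X : C, X ⟶ RA X)
    (hA : ∀ X : C, IsReflection A (η X))
    (hAcow : CowellpoweredSub A)
    (B : Set C) (hB : ReflectiveSub B)
    (hsame : SameRegClosure A B)
    (hyp : AlphaMonoHyp A RA η B ∨ IsSeparator (⊤_ C)) :
    CowellpoweredSub B := by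
  refine .of_mono_reflection hwp hA hAcow (fun f => Cancellable.of_sameRegClosure hwp hsame)
    fun Y hY => ?_
  rcases hyp with hα | hsep
  · exact mono_reflection_of_alphaMonoHyp hwp hA hsame hα hY
  · exact mono_reflection_of_isSeparator_terminal hwp hA hsame hsep hY

end RegularClosure
end

section
/- Let 𝒳 be a complete, wellpowered and cowellpowered category (with equalizers and cokernel pairs), let 𝒜 be a reflective and cowellpowered subcategory of 𝒳, and let ℬ be a reflective subcategory whose objects are the 𝒳-subobjects of 𝒜-objects. If either (i) for each object X in ℬ the canonical morphism α_{U,X} (with respect to the reflector of 𝒜) is a monomorphism in 𝒜 for all objects U of 𝒳, or (ii) the terminal object of 𝒳 is a generator of 𝒳, then ℬ is an intermediate cowellpowered subcategory of the pair (𝒜, 𝒳). -/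
open CategoryTheory Limits

universe v u

namespace RegularClosure

variable {C : Type u} [Category.{v} C]

/-- An object embedding into an `A`-object embeds into its `A`-reflection. -/
theorem IsReflection.mono_of_mem_sClos {A : Set C} {X RX : C} {r : X ⟶ RX}
    (hr : IsReflection A r) (hX : X ∈ SClos A) : Mono r := by
  obtain ⟨A', hA', m, hm⟩ := hX
  obtain ⟨g, hg, -⟩ := hr.2 hA' m
  subst hg
  exact mono_of_mono r g

theorem mem_sClos_of_mono {A : Set C} {X Y : C} (m : X ⟶ Y) [Mono m] (hY : Y ∈ SClos A) :
    X ∈ SClos A := by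
  obtain ⟨A', hA', n, hn⟩ := hY
  exact ⟨A', hA', m ≫ n, mono_comp m n⟩

theorem subset_sClos (A : Set C) : A ⊆ SClos A :=
  fun X hX => ⟨X, hX, 𝟙 X, inferInstance⟩

/-- Reflections into a subcategory closed under subobjects are epimorphisms. -/
theorem IsReflection.epi_of_closed_under_mono [HasEqualizers C] {B : Set C}
    (hsub : ∀ {X Y : C} (m : X ⟶ Y), Mono m → Y ∈ B → X ∈ B)
    {X RX : C} {r : X ⟶ RX} (hr : IsReflection B r) : Epi r := by
  refine ⟨fun {Z} u v huv => ?_⟩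
  obtain ⟨g, hg, -⟩ := hr.2 (hsub (equalizer.ι u v) inferInstance hr.1) (equalizer.lift r huv)
  have hid : g ≫ equalizer.ι u v = 𝟙 RX := by
    refine (hr.2 hr.1 r).unique ?_ (Category.comp_id r)
    rw [← Category.assoc, hg, equalizer.lift_ι]
  calc u = g ≫ equalizer.ι u v ≫ u := by rw [← Category.assoc, hid, Category.id_comp]
    _ = g ≫ equalizer.ι u v ≫ v := by rw [equalizer.condition]
    _ = v := by rw [← Category.assoc, hid, Category.id_comp]

/-- Cancellation against `A`-objects implies cancellation against their subobjects. -/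
theorem IsEpiIn.sClos {A : Set C} {X Y : C} {f : X ⟶ Y} (hf : IsEpiIn A f) :
    IsEpiIn (SClos A) f := by
  rintro Z ⟨A', hA', m, hm⟩ u v huv
  rw [← cancel_mono m]
  refine hf hA' _ _ ?_
  rw [← Category.assoc, huv, Category.assoc]

theorem IsReflection.isEpiIn {A : Set C} {X RX : C} {r : X ⟶ RX} (hr : IsReflection A r) :
    IsEpiIn A r :=
  fun hZ _ v huv => (hr.2 hZ (r ≫ v)).unique huv rfl

/-- The morphism induced between reflections by an `A`-cancellable morphism is
`A`-cancellable. -/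
theorem IsReflection.isEpiIn_of_comp_eq {A : Set C} {X Y RX RY : C} {r : X ⟶ RX} {s : Y ⟶ RY}
    (hs : IsReflection A s) {f : X ⟶ Y} (hf : IsEpiIn A f) {g : RX ⟶ RY}
    (hg : r ≫ g = f ≫ s) : IsEpiIn A g := by
  intro Z hZ u v huv
  refine hs.isEpiIn hZ u v (hf hZ _ _ ?_)
  rw [← Category.assoc, ← Category.assoc, ← hg, Category.assoc, huv, Category.assoc]

/-- In a wellpowered category, the subobjects of the objects of a cowellpowered reflective
subcategory form a cowellpowered subcategory. -/
theorem CowellpoweredSub.sClos (hwp : WellpoweredCat C) {A : Set C} (hA : ReflectiveSub A)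
    (hAcow : CowellpoweredSub A) : CowellpoweredSub (SClos A) := by
  intro X _
  obtain ⟨RX, r, hr⟩ := hA X
  obtain ⟨ι, Q, q, -, hq⟩ := hAcow RX hr.1
  choose κ S s _ hs using fun i => hwp (Q i)
  refine ⟨Σ (i : ι) (j : κ i), {h : X ⟶ S i j // S i j ∈ SClos A ∧ IsEpiIn (SClos A) h},
    fun p => S p.1 p.2.1, fun p => p.2.2.1, fun p => p.2.2.2, ?_⟩
  intro Y f hY hf
  obtain ⟨RY, t, ht⟩ := hA Y
  have : Mono t := ht.mono_of_mem_sClos hY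
  obtain ⟨g, hg, -⟩ := hr.2 ht.1 (f ≫ t)
  have hgA : IsEpiIn A g :=
    ht.isEpiIn_of_comp_eq (fun hZ => hf (subset_sClos A hZ)) hg
  obtain ⟨i, e, -⟩ := hq g ht.1 hgA
  obtain ⟨j, e', -⟩ := hs i (t ≫ e.inv) (mono_comp t e.inv)
  refine ⟨⟨i, j, f ≫ e'.inv, mem_sClos_of_mono e'.hom hY, ?_⟩, e', by simp⟩
  intro Z hZ u v huv
  rw [← cancel_epi e'.inv]
  exact hf hZ _ _ (by simpa using huv)

/-- Let `C` be a complete, wellpowered and cowellpowered category (with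
equalizers and cokernel pairs), `A` a reflective and cowellpowered subcategory with
reflection data `(RA, η)`, and `B` a reflective subcategory whose objects are the
`C`-subobjects of `A`-objects. If either (i) the canonical morphisms `α_{U,X}` (for
`X ∈ B`) are monomorphisms in `A`, or (ii) the terminal object of `C` is a generator,
then `B` is an intermediate cowellpowered subcategory of the pair `(A, C)`. -/
theorem statement15 [HasLimits C] [HasEqualizers C]
    (hcp : HasCokernelPairs C)
    (hwp : WellpoweredCat C) (hcow : CowellpoweredSub (Set.univ : Set C))
    (A : Set C) (RA : C → C) (η : ∀ X : C, X ⟶ RA X)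
    (hA : ∀ X : C, IsReflection A (η X))
    (hAcow : CowellpoweredSub A)
    (B : Set C) (hB : ReflectiveSub B) (hBobj : B = SClos A)
    (hyp : AlphaMonoHyp A RA η B ∨ IsSeparator (⊤_ C)) :
    Intermediate A B ∧ CowellpoweredSub B := by
  subst hBobj
  refine ⟨⟨⟨Set.subset_univ _, fun X _ => ?_⟩, subset_sClos A, fun X _ => ?_⟩,
    hAcow.sClos hwp fun X => ⟨RA X, η X, hA X⟩⟩
  · obtain ⟨RX, r, hr⟩ := hB X
    have : Epi r := hr.epi_of_closed_under_mono fun m _ hY => mem_sClos_of_mono m hY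
    exact ⟨RX, r, hr.1, fun _ u v huv => (cancel_epi r).1 huv, hr.2⟩
  · exact ⟨RA X, η X, (hA X).1, IsEpiIn.sClos (hA X).isEpiIn, (hA X).2⟩

end RegularClosure
end

section
/- Let 𝒳 be a complete, wellpowered and cowellpowered category (with equalizers and cokernel pairs). Let 𝒜 be an extremally epireflective subcategory of 𝒳 satisfying condition (*), and let ℬ be a non-cowellpowered reflective subcategory of 𝒳 such that the inclusion ℬ ⟶ 𝒜 preserves epimorphisms. If 𝒜 and ℬ induce the same regular closure operators, then 𝒜 is not cowellpowered. -/
open CategoryTheory Limits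

universe v u

namespace RegularClosure

variable {C : Type u} [Category.{v} C]

/-- An equalizer of a pair of morphisms into a `B`-object is its own `B`-regular closure. -/
theorem isRegClosure_self {B : Set C} {X Y : C} (hY : Y ∈ B) {h k : X ⟶ Y} [HasEqualizer h k] :
    IsRegClosure B (equalizer.ι h k) (equalizer.ι h k) :=
  ⟨inferInstance, fun _ _ _ hle => hle, fun _ _ hs =>
    hs _ inferInstance ⟨Y, h, k, equalizer.condition h k, hY, ⟨equalizerIsEqualizer h k⟩⟩
      ⟨𝟙 _, Category.id_comp _⟩⟩

/-- In a complete wellpowered category, the intersection of all `A`-regular monomorphisms above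
`m` exists, and every morphism equalizing the pairs into `A`-objects equalized by `m` factors
through it. -/
theorem exists_mono_le_aRegular [HasLimits C] {A : Set C} (hwp : WellpoweredCat C)
    {M X : C} (m : M ⟶ X) :
    ∃ (P : C) (p : P ⟶ X), Mono p ∧
      (∀ {T : C} (t : T ⟶ X), Mono t → IsARegular A t → MonoLE m t → MonoLE p t) ∧
      ∀ {S : C} (s : S ⟶ X),
        (∀ {Y : C}, Y ∈ A → ∀ h k : X ⟶ Y, m ≫ h = m ≫ k → s ≫ h = s ≫ k) →
        ∃ u : S ⟶ P, u ≫ p = s := by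
  obtain ⟨ι, D, d, -, hd⟩ := hwp X
  let J : Type v := {i : ι // ∃ (Y : C) (h k : X ⟶ Y), Y ∈ A ∧ m ≫ h = m ≫ k ∧
    ∀ {W : C} (x : W ⟶ X), x ≫ h = x ≫ k → ∃ u : W ⟶ D i, u ≫ d i = x}
  choose Y h k hY hm hfac using fun j : J => j.2
  refine ⟨equalizer (Pi.lift h) (Pi.lift k), equalizer.ι _ _, inferInstance, ?_, ?_⟩
  · rintro T t ht ⟨Z, a, b, w, hZ, ⟨hlim⟩⟩ ⟨v, hv⟩
    obtain ⟨i, e, he⟩ := hd t ht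
    let j : J := ⟨i, Z, a, b, hZ, by rw [← hv, Category.assoc, w, Category.assoc], fun x hx => by
      obtain ⟨l, hl⟩ := Fork.IsLimit.lift' hlim x hx
      refine ⟨l ≫ e.inv, ?_⟩
      rw [Category.assoc, ← he, e.inv_hom_id_assoc]
      exact hl⟩
    obtain ⟨l, hl⟩ := hfac j (equalizer.ι (Pi.lift h) (Pi.lift k)) (by
      simpa using equalizer.condition (Pi.lift h) (Pi.lift k) =≫ Pi.π Y j)
    exact ⟨l ≫ e.hom, by rw [Category.assoc, he, hl]⟩
  · intro S s hs
    refine ⟨equalizer.lift s (Pi.hom_ext _ _ fun j => ?_), equalizer.lift_ι _ _⟩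
    simpa using hs (hY j) (h j) (k j) (hm j)

/-- If `A` is reflective, satisfies condition (*) and induces the same regular closure operator
as `B`, then `B` is contained in `A`. -/
theorem subset_of_starCondition [HasLimits C] (hwp : WellpoweredCat C)
    {A B : Set C} {RA : C → C} {η : ∀ X : C, X ⟶ RA X}
    (hA : ∀ X : C, IsReflection A (η X)) (hstar : StarCondition A RA η)
    (hsame : SameRegClosure A B) : B ⊆ A := by
  intro X hX
  by_contra hXA
  obtain ⟨Z, f, g, hne, hη, gbar, hgbar, hg⟩ := hstar X hXA
  have hEA : IsRegClosure A (equalizer.ι (𝟙 X) (gbar ≫ g)) (equalizer.ι (𝟙 X) (gbar ≫ g)) :=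
    (hsame _ inferInstance _).2 (isRegClosure_self hX)
  obtain ⟨T, p, hp, hple, hpf⟩ := exists_mono_le_aRegular (A := A) hwp
    (equalizer.ι (𝟙 X) (gbar ≫ g))
  obtain ⟨u, hu⟩ := hEA.2.2 p hp hple
  have hgm : g ≫ 𝟙 X = g ≫ gbar ≫ g := by rw [hg, Category.comp_id]
  obtain ⟨w, hw⟩ := hpf f (by
    intro Y hY h k hhk
    obtain ⟨h', rfl, -⟩ := (hA X).2 hY h
    obtain ⟨k', rfl, -⟩ := (hA X).2 hY k
    have key : g ≫ η X ≫ h' = g ≫ η X ≫ k' := by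
      rw [← equalizer.lift_ι g hgm, Category.assoc, hhk, Category.assoc]
    simpa only [← Category.assoc, hη] using key)
  apply hne
  have hfac : f = (w ≫ u) ≫ equalizer.ι (𝟙 X) (gbar ≫ g) := by
    rw [Category.assoc, hu, hw]
  calc f = f ≫ 𝟙 X := (Category.comp_id f).symm
    _ = f ≫ gbar ≫ g := by
      rw [hfac, Category.assoc, equalizer.condition, ← Category.assoc]
    _ = g := by rw [← Category.assoc, ← hgbar, Category.assoc, hg]

/-- Cowellpoweredness passes from `A` to a subcategory `B` whose inclusion into `A` preserves
epimorphisms. -/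
theorem CowellpoweredSub.of_subset {A B : Set C} (hBA : B ⊆ A)
    (hpres : ∀ {X Y : C}, X ∈ B → Y ∈ B → ∀ f : X ⟶ Y, IsEpiIn B f → IsEpiIn A f)
    (hcow : CowellpoweredSub A) : CowellpoweredSub B := by
  intro X hX
  obtain ⟨ι, Q, q, -, hq⟩ := hcow X (hBA hX)
  let J : Type v := {i : ι // ∃ (Y : C) (f : X ⟶ Y) (e : Q i ≅ Y),
    Y ∈ B ∧ IsEpiIn B f ∧ q i ≫ e.hom = f}
  choose Y f e hY hf he using fun j : J => j.2
  refine ⟨J, Y, f, fun j => ⟨hY j, hf j⟩, fun {Z} g hZ hg => ?_⟩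
  obtain ⟨i, e', he'⟩ := hq g (hBA hZ) (hpres hX hZ g hg)
  let j : J := ⟨i, Z, g, e', hZ, hg, he'⟩
  refine ⟨j, (e j).symm ≪≫ e', ?_⟩
  rw [← he j]
  simpa using he'

/-- Let `C` be a complete, wellpowered and cowellpowered category (with
equalizers and cokernel pairs). Let `A` be an extremally epireflective subcategory
satisfying condition (*), and let `B` be a non-cowellpowered reflective subcategory such
that the inclusion `B ⟶ A` preserves epimorphisms. If `A` and `B` induce the same regular
closure operators, then `A` is not cowellpowered. -/
theorem statement17 [HasLimits C] [HasEqualizers C]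
    (hcp : HasCokernelPairs C)
    (hwp : WellpoweredCat C) (hcow : CowellpoweredSub (Set.univ : Set C))
    (A : Set C) (RA : C → C) (η : ∀ X : C, X ⟶ RA X)
    (hA : ∀ X : C, IsReflection A (η X))
    (hAext : ∀ X : C, ExtremalEpi (η X))
    (hstar : StarCondition A RA η)
    (B : Set C) (hB : ReflectiveSub B)
    (hBncow : ¬ CowellpoweredSub B)
    (hpres : ∀ {X Y : C}, X ∈ B → Y ∈ B → ∀ f : X ⟶ Y, IsEpiIn B f → IsEpiIn A f)
    (hsame : SameRegClosure A B) :
    ¬ CowellpoweredSub A := by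
  exact fun hAcow =>
    hBncow (hAcow.of_subset (subset_of_starCondition hwp hA hstar hsame) hpres)

end RegularClosure
end
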